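/- For N even and 2 ≤ l ≤ N/2 − 1, the fiber over the subspace E ∩ E_{N−2l} = span(e_1,…,e_{N−2l}) of the map ξ : Σ_{l,N} → OG(N−2l, V), [a+b] ↦ H_a ∩ H_b, is isomorphic (via the injective linear map w ↦ e_{[N−2l]} ∧ w) to the maximal-distance secant orbit Σ_{l,2l} of the smaller Spinor variety S_{2l}^+. -/

import Mathlib

/- Formalization of a statement about spinor varieties (Galgano, arXiv:2302.05295). -/

noncomputable section
open CliffordAlgebra

/-- The model for the maximal isotropic subspace `E`. -/
abbrev Evec (N : ℕ) := Fin N → ℂ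

/-- The model for `V = E ⊕ E^∨`: a pair `(e, f)` represents `∑ eᵢ • eᵢ + ∑ fᵢ • fᵢ`. -/
abbrev Vsp (N : ℕ) := (Fin N → ℂ) × (Fin N → ℂ)

/-- The exterior algebra `⋀ E` hosting the (sums of half-) spin representations. -/
abbrev ExtE (N : ℕ) := ExteriorAlgebra ℂ (Evec N)

/-- `b ↦ (a ↦ ∑ aᵢ bᵢ)`, identifying `E` with its dual. -/
def toDualMap (N : ℕ) : Evec N →ₗ[ℂ] Module.Dual ℂ (Evec N) where
  toFun b := ∑ i, b i • LinearMap.proj i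
  map_add' x y := by simp [add_smul, Finset.sum_add_distrib]
  map_smul' c x := by simp [smul_smul, Finset.smul_sum]

/-- Clifford multiplication on the spinor module `⋀E` by an element
`v = (e, f) ∈ V = E ⊕ E^∨`: wedge by `e` plus contraction by `f`; bundled as a
linear map in `v`, for a fixed spinor `x`.  `psi x v = v ⋅ x`. -/
def psi {N : ℕ} (x : ExtE N) : Vsp N →ₗ[ℂ] ExtE N :=
  (LinearMap.mulRight ℂ x).comp ((ExteriorAlgebra.ι ℂ).comp (LinearMap.fst ℂ _ _)) +
  ((CliffordAlgebra.contractLeft (Q := (0 : QuadraticForm ℂ (Evec N)))).flip x).comp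
    ((toDualMap N).comp (LinearMap.snd ℂ _ _))

/-- The even part `⋀^{ev} E` of the exterior algebra (one half-spin representation). -/
def evenPart (N : ℕ) : Submodule ℂ (ExtE N) :=
  CliffordAlgebra.evenOdd (0 : QuadraticForm ℂ (Evec N)) 0

/-- The odd part `⋀^{od} E` of the exterior algebra (the other half-spin representation). -/
def oddPart (N : ℕ) : Submodule ℂ (ExtE N) :=
  CliffordAlgebra.evenOdd (0 : QuadraticForm ℂ (Evec N)) 1

/-- A (representative of a) pure spinor of the even half-spin representation:
a nonzero even spinor whose isotropic annihilator `H_a = ker ψ_a` is maximal,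
of dimension `N`. -/
def purespinor {N : ℕ} (a : ExtE N) : Prop :=
  a ≠ 0 ∧ a ∈ evenPart N ∧ Module.finrank ℂ (LinearMap.ker (psi a)) = N

/-- The spinor variety `S_N^+`, as a set of points of the projective space
`ℙ(⋀^{ev}E) ⊆ ℙ(⋀E)`. -/
def SpinorVariety (N : ℕ) : Set (Projectivization ℂ (ExtE N)) :=
  {p | ∃ (a : ExtE N) (h : a ≠ 0), purespinor a ∧ p = Projectivization.mk ℂ a h}

/-- The projective line through `p` and `q` is contained in `X`. -/
def lineIn {K V : Type*} [DivisionRing K] [AddCommGroup V] [Module K V]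
    (X : Set (Projectivization K V)) (p q : Projectivization K V) : Prop :=
  ∀ r : Projectivization K V, r.submodule ≤ p.submodule ⊔ q.submodule → r ∈ X

/-- There is a chain of `r` lines inside `X` connecting `p` to `q`. -/
def chainDist {K V : Type*} [DivisionRing K] [AddCommGroup V] [Module K V]
    (X : Set (Projectivization K V)) (p q : Projectivization K V) (r : ℕ) : Prop :=
  ∃ c : ℕ → Projectivization K V, c 0 = p ∧ c r = q ∧ (∀ i ≤ r, c i ∈ X) ∧
    ∀ i < r, lineIn X (c i) (c (i + 1))

/-- The Hamming distance on `X`: the minimal number of lines inside `X` needed to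
connect `p` to `q`. -/
def hdist {K V : Type*} [DivisionRing K] [AddCommGroup V] [Module K V]
    (X : Set (Projectivization K V)) (p q : Projectivization K V) : ℕ :=
  sInf {r | chainDist X p q r}

/-- The wedge product `e_I = e_{i₁} ∧ ⋯ ∧ e_{i_k}` over the sorted index set `I`. -/
def eI {N : ℕ} (I : Finset (Fin N)) : ExtE N :=
  ((I.sort (· ≤ ·)).map (fun i => ExteriorAlgebra.ι ℂ (Pi.single i 1))).prod

/-- Padding embedding of `ℂ^{2l}` into the last `2l` coordinates of `ℂ^N`. -/
def padMap (N l : ℕ) (h : 2 * l ≤ N) : Evec (2 * l) →ₗ[ℂ] Evec N where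
  toFun x k := if hk : N - 2 * l ≤ k.1 then
    x (⟨k.1 - (N - 2 * l), by have := k.isLt; omega⟩ : Fin (2 * l)) else 0
  map_add' x y := by
    funext k
    simp only [Pi.add_apply]
    split_ifs with h <;> simp
  map_smul' c x := by
    funext k
    simp only [Pi.smul_apply, RingHom.id_apply]
    split_ifs with h <;> simp

/-- The polar form of the quadratic form `q (e, f) = ∑ eᵢ fᵢ` on `V = E ⊕ E^∨`. -/
def polarForm (N : ℕ) : LinearMap.BilinForm ℂ (Vsp N) :=
  ((toDualMap N).flip.compl₁₂ (LinearMap.fst ℂ _ _) (LinearMap.snd ℂ _ _)) +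
    ((toDualMap N).compl₁₂ (LinearMap.snd ℂ _ _) (LinearMap.fst ℂ _ _))

theorem toDualMap_apply {N : ℕ} (f e : Evec N) : toDualMap N f e = ∑ i, f i * e i := by
  simp [toDualMap]

theorem polarForm_eq {N : ℕ} (v w : Vsp N) :
    polarForm N v w = toDualMap N w.2 v.1 + toDualMap N v.2 w.1 := rfl

theorem polarForm_symm {N : ℕ} (v w : Vsp N) : polarForm N v w = polarForm N w v := by
  rw [polarForm_eq, polarForm_eq, add_comm]

theorem polarForm_isRefl (N : ℕ) : (polarForm N).IsRefl := fun v w h => by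
  rw [polarForm_symm, h]

theorem polarForm_single_left {N : ℕ} (i : Fin N) (v : Vsp N) :
    polarForm N (Pi.single i 1, 0) v = v.2 i := by
  simp [polarForm_eq, toDualMap_apply, Pi.single_apply]

theorem polarForm_single_right {N : ℕ} (i : Fin N) (v : Vsp N) :
    polarForm N (0, Pi.single i 1) v = v.1 i := by
  simp [polarForm_eq, toDualMap_apply, Pi.single_apply]

theorem polarForm_nondegenerate (N : ℕ) : (polarForm N).Nondegenerate := by
  refine (polarForm_isRefl N).nondegenerate_iff_separatingRight.2 ?_
  intro v hv
  refine Prod.ext (funext fun i => ?_) (funext fun i => ?_)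
  · rw [← polarForm_single_right, hv]; rfl
  · rw [← polarForm_single_left, hv]; rfl

theorem psi_apply {N : ℕ} (x : ExtE N) (v : Vsp N) :
    psi x v = ExteriorAlgebra.ι ℂ v.1 * x +
      contractLeft (Q := (0 : QuadraticForm ℂ (Evec N))) (toDualMap N v.2) x := rfl

theorem psi_add {N : ℕ} (x y : ExtE N) (v : Vsp N) : psi (x + y) v = psi x v + psi y v := by
  simp only [psi_apply, mul_add, map_add]; abel

theorem psi_smul {N : ℕ} (c : ℂ) (x : ExtE N) (v : Vsp N) : psi (c • x) v = c • psi x v := by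
  simp only [psi_apply, mul_smul_comm, map_smul, smul_add]

theorem psi_zero {N : ℕ} (v : Vsp N) : psi (0 : ExtE N) v = 0 := by
  simp [psi_apply]

theorem psi_neg {N : ℕ} (x : ExtE N) (v : Vsp N) : psi (-x) v = -psi x v := by
  rw [← neg_one_smul ℂ, psi_smul, neg_one_smul]

theorem ker_psi_smul {N : ℕ} {c : ℂ} (hc : c ≠ 0) (x : ExtE N) :
    LinearMap.ker (psi (c • x)) = LinearMap.ker (psi x) := by
  ext v; simp [psi_smul, hc]

theorem ι_mul_ι_mul_add_swap {N : ℕ} (e e' : Evec N) (x : ExtE N) :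
    ExteriorAlgebra.ι ℂ e * (ExteriorAlgebra.ι ℂ e' * x) +
      ExteriorAlgebra.ι ℂ e' * (ExteriorAlgebra.ι ℂ e * x) = 0 := by
  rw [← mul_assoc, ← mul_assoc, ← add_mul, ExteriorAlgebra.ι_add_mul_swap, zero_mul]

/-- The Clifford relation for the action of `V` on the spinor module. -/
theorem psi_psi_add_swap {N : ℕ} (x : ExtE N) (v w : Vsp N) :
    psi (psi x w) v + psi (psi x v) w = polarForm N v w • x := by
  simp only [psi_apply, map_add, mul_add, contractLeft_ι_mul, polarForm_eq, add_smul]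
  rw [contractLeft_comm (toDualMap N v.2) (toDualMap N w.2) x]
  have h := ι_mul_ι_mul_add_swap v.1 w.1 x
  rw [← sub_eq_zero, ← h]
  abel

theorem psi_psi_swap {N : ℕ} {x : ExtE N} {v : Vsp N} (w : Vsp N) (hv : psi x v = 0) :
    psi (psi x w) v = polarForm N v w • x := by
  rw [← psi_psi_add_swap, hv, psi_zero, add_zero]

theorem psi_psi_self {N : ℕ} (x : ExtE N) {v : Vsp N} (hv : polarForm N v v = 0) :
    psi (psi x v) v = 0 := by
  have h := psi_psi_add_swap x v v
  rw [hv, zero_smul, ← two_smul ℂ] at h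
  exact (smul_eq_zero.1 h).resolve_left two_ne_zero

theorem polarForm_eq_zero_of_mem_ker {N : ℕ} {x : ExtE N} (hx : x ≠ 0) {v w : Vsp N}
    (hv : psi x v = 0) (hw : psi x w = 0) : polarForm N v w = 0 := by
  have h := psi_psi_add_swap x v w
  rw [hv, hw, psi_zero, psi_zero, add_zero] at h
  exact (smul_eq_zero.1 h.symm).resolve_right hx

theorem finrank_le_of_isotropic {N : ℕ} {W : Submodule ℂ (Vsp N)}
    (hW : ∀ v ∈ W, ∀ w ∈ W, polarForm N v w = 0) : Module.finrank ℂ W ≤ N := by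
  have h1 : W ≤ (polarForm N).orthogonal W := fun v hv w hw => hW w hw v hv
  have h2 := Submodule.finrank_mono h1
  rw [LinearMap.BilinForm.finrank_orthogonal (polarForm_nondegenerate N)] at h2
  simp at h2
  omega

theorem finrank_ker_psi_le {N : ℕ} {x : ExtE N} (hx : x ≠ 0) :
    Module.finrank ℂ (LinearMap.ker (psi x)) ≤ N :=
  finrank_le_of_isotropic fun _ hv _ hw => polarForm_eq_zero_of_mem_ker hx hv hw

theorem finrank_le_inf_ker_add_one {N : ℕ} (W : Submodule ℂ (Vsp N)) (u : Vsp N) :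
    Module.finrank ℂ W ≤
      Module.finrank ℂ (W ⊓ LinearMap.ker (polarForm N u) : Submodule ℂ (Vsp N)) + 1 := by
  have h := LinearMap.finrank_range_add_finrank_ker ((polarForm N u).domRestrict W)
  have h1 : Module.finrank ℂ (LinearMap.range ((polarForm N u).domRestrict W)) ≤ 1 :=
    (Submodule.finrank_le _).trans (by simp)
  have h2 : (LinearMap.ker ((polarForm N u).domRestrict W)).map W.subtype =
      W ⊓ LinearMap.ker (polarForm N u) := by
    ext v; simp [and_comm]
  rw [← h2, Submodule.finrank_map_subtype_eq]
  omega

theorem contractLeft_mem_evenOdd {N : ℕ} (d : Module.Dual ℂ (Evec N)) {i : ZMod 2} {x : ExtE N}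
    (hx : x ∈ evenOdd (0 : QuadraticForm ℂ (Evec N)) i) :
    contractLeft (Q := (0 : QuadraticForm ℂ (Evec N))) d x ∈
      evenOdd (0 : QuadraticForm ℂ (Evec N)) (i + 1) := by
  have h11 : (1 + 1 : ZMod 2) = 0 := rfl
  induction x, hx using evenOdd_induction with
  | range_ι_pow v h =>
    obtain rfl | rfl : i = 0 ∨ i = 1 := (by decide : ∀ i : ZMod 2, i = 0 ∨ i = 1) i
    · obtain ⟨r, rfl⟩ := Submodule.mem_one.mp h
      rw [contractLeft_algebraMap]
      exact zero_mem _
    · simp_rw [ZMod.val_one, pow_one] at h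
      obtain ⟨v, rfl⟩ := h
      rw [contractLeft_ι, h11]
      exact SetLike.algebraMap_mem_graded _ _
  | add x y hx hy ihx ihy =>
    rw [map_add]
    exact add_mem ihx ihy
  | ι_mul_ι_mul m₁ m₂ x hx ih =>
    have hι : ∀ (m : Evec N) (j : ZMod 2) {y : ExtE N},
        y ∈ evenOdd (0 : QuadraticForm ℂ (Evec N)) j →
        ι (0 : QuadraticForm ℂ (Evec N)) m * y ∈
          evenOdd (0 : QuadraticForm ℂ (Evec N)) (j + 1) := fun m j y hy => by
      rw [add_comm]
      exact SetLike.mul_mem_graded (ι_mem_evenOdd_one _ m) hy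
    rw [mul_assoc, contractLeft_ι_mul, contractLeft_ι_mul]
    refine sub_mem (Submodule.smul_mem _ _ (hι _ _ hx)) (hι _ _ (sub_mem ?_ ?_))
    · exact Submodule.smul_mem _ _ hx
    · have := hι m₂ _ ih
      rwa [add_assoc, h11, add_zero] at this

theorem psi_mem_evenOdd {N : ℕ} (v : Vsp N) {i : ZMod 2} {x : ExtE N}
    (hx : x ∈ evenOdd (0 : QuadraticForm ℂ (Evec N)) i) :
    psi x v ∈ evenOdd (0 : QuadraticForm ℂ (Evec N)) (i + 1) := by
  rw [psi_apply]
  refine add_mem ?_ (contractLeft_mem_evenOdd _ hx)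
  rw [add_comm]
  exact SetLike.mul_mem_graded (ι_mem_evenOdd_one _ _) hx

theorem psi_psi_mem_evenPart {N : ℕ} (u v : Vsp N) {x : ExtE N} (hx : x ∈ evenPart N) :
    psi (psi x u) v ∈ evenPart N :=
  psi_mem_evenOdd (i := 1) v (psi_mem_evenOdd (i := 0) u hx)

/-- The wedge product `e_{i₁} ∧ ⋯ ∧ e_{i_k}` over a list of indices. -/
def wedgeList {N : ℕ} (L : List (Fin N)) : ExtE N :=
  (L.map fun i => ExteriorAlgebra.ι ℂ (Pi.single i 1 : Evec N)).prod

theorem wedgeList_nil {N : ℕ} : wedgeList ([] : List (Fin N)) = 1 := rfl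

theorem wedgeList_cons {N : ℕ} (i : Fin N) (L : List (Fin N)) :
    wedgeList (i :: L) = ExteriorAlgebra.ι ℂ (Pi.single i 1 : Evec N) * wedgeList L :=
  List.prod_cons

/-- Contraction against the `i`-th coordinate functional. -/
def contractCoord {N : ℕ} (i : Fin N) : ExtE N →ₗ[ℂ] ExtE N :=
  contractLeft (Q := (0 : QuadraticForm ℂ (Evec N))) (LinearMap.proj i)

/-- Successive contraction against the coordinate functionals of a list of indices. -/
def contractList {N : ℕ} : List (Fin N) → ExtE N →ₗ[ℂ] ExtE N
  | [] => LinearMap.id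
  | i :: L => contractList L ∘ₗ contractCoord i

theorem contractCoord_ι_mul {N : ℕ} (i : Fin N) (e : Evec N) (x : ExtE N) :
    contractCoord i (ExteriorAlgebra.ι ℂ e * x) =
      e i • x - ExteriorAlgebra.ι ℂ e * contractCoord i x :=
  contractLeft_ι_mul _ _ _

theorem eq_wedgeList_mul {N : ℕ} {L : List (Fin N)} (hL : L.Nodup) {x : ExtE N}
    (hx : ∀ i ∈ L, ExteriorAlgebra.ι ℂ (Pi.single i 1 : Evec N) * x = 0) :
    x = wedgeList L * contractList L x := by
  induction L generalizing x with
  | nil => simp [wedgeList_nil, contractList]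
  | cons i L ih =>
    obtain ⟨hi, hL⟩ := List.nodup_cons.1 hL
    have h1 : x = ExteriorAlgebra.ι ℂ (Pi.single i 1 : Evec N) * contractCoord i x := by
      have := contractCoord_ι_mul i (Pi.single i 1) x
      rw [hx i (by simp), map_zero, Pi.single_eq_same, one_smul] at this
      exact sub_eq_zero.1 this.symm
    rw [wedgeList_cons, mul_assoc, contractList, LinearMap.comp_apply, ← ih hL, ← h1]
    intro j hj
    have hij : i ≠ j := fun h => hi (h ▸ hj)
    have := contractCoord_ι_mul i (Pi.single j 1) x
    rw [hx j (by simp [hj]), map_zero, Pi.single_eq_of_ne hij, zero_smul, zero_sub] at this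
    exact neg_eq_zero.1 this.symm

theorem wedgeList_mul_ι {N : ℕ} (L : List (Fin N)) (e : Evec N) :
    wedgeList L * ExteriorAlgebra.ι ℂ e =
      (-1 : ℂ) ^ L.length • (ExteriorAlgebra.ι ℂ e * wedgeList L) := by
  induction L with
  | nil => simp [wedgeList_nil]
  | cons i L ih =>
    have h := ι_mul_ι_mul_add_swap (Pi.single i 1) e (wedgeList L)
    rw [wedgeList_cons, mul_assoc, ih, List.length_cons, pow_succ, mul_smul_comm,
      eq_neg_of_add_eq_zero_left h]
    simp

theorem ι_mul_wedgeList_of_mem {N : ℕ} {L : List (Fin N)} {i : Fin N} (hi : i ∈ L) :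
    ExteriorAlgebra.ι ℂ (Pi.single i 1 : Evec N) * wedgeList L = 0 := by
  induction L with
  | nil => simp at hi
  | cons j L ih =>
    rw [wedgeList_cons]
    rcases List.mem_cons.1 hi with rfl | hi
    · rw [← mul_assoc, ExteriorAlgebra.ι_sq_zero, zero_mul]
    · rw [eq_neg_of_add_eq_zero_left (ι_mul_ι_mul_add_swap _ _ _), ih hi, mul_zero, neg_zero]

theorem wedgeList_mul_ι_of_support {N : ℕ} {L : List (Fin N)} {e : Evec N}
    (he : ∀ i ∉ L, e i = 0) : wedgeList L * ExteriorAlgebra.ι ℂ e = 0 := by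
  have h : e = ∑ i, e i • (Pi.single i 1 : Evec N) := by
    funext j; simp [Finset.sum_apply, Pi.single_apply]
  rw [wedgeList_mul_ι, h, map_sum, Finset.sum_mul, Finset.sum_eq_zero, smul_zero]
  intro i _
  rw [map_smul, smul_mul_assoc]
  by_cases hi : i ∈ L
  · rw [ι_mul_wedgeList_of_mem hi, smul_zero]
  · rw [he i hi, zero_smul]

theorem wedgeList_mul_ι_congr {N : ℕ} {L : List (Fin N)} {e e' : Evec N}
    (he : ∀ i ∉ L, e i = e' i) :
    wedgeList L * ExteriorAlgebra.ι ℂ e = wedgeList L * ExteriorAlgebra.ι ℂ e' := by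
  rw [← sub_eq_zero, ← mul_sub, ← map_sub]
  exact wedgeList_mul_ι_of_support fun i hi => by simp [he i hi]

theorem wedgeList_mul_map {N : ℕ} {L : List (Fin N)} {p : Evec N →ₗ[ℂ] Evec N}
    (hp : ∀ e, ∀ i ∉ L, p e i = e i) (x : ExtE N) :
    wedgeList L * ExteriorAlgebra.map p x = wedgeList L * x := by
  induction x using CliffordAlgebra.left_induction with
  | algebraMap r =>
    congr 1
    exact AlgHom.commutes _ _
  | add x y hx hy => rw [map_add, mul_add, mul_add, hx, hy]
  | ι_mul x m hx =>
    have h1 : ExteriorAlgebra.map p (ExteriorAlgebra.ι ℂ m * x) =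
        ExteriorAlgebra.ι ℂ (p m) * ExteriorAlgebra.map p x := by
      rw [map_mul, ExteriorAlgebra.map_apply_ι]
    change wedgeList L * ExteriorAlgebra.map p (ExteriorAlgebra.ι ℂ m * x) =
      wedgeList L * (ExteriorAlgebra.ι ℂ m * x)
    rw [h1, ← mul_assoc, ← mul_assoc, wedgeList_mul_ι, smul_mul_assoc, mul_assoc, hx, ← mul_assoc,
      ← smul_mul_assoc, ← wedgeList_mul_ι, wedgeList_mul_ι_congr (hp m)]

theorem map_zero_eq_algebraMap {N : ℕ} (x : ExtE N) :
    ∃ c : ℂ, ExteriorAlgebra.map (0 : Evec N →ₗ[ℂ] Evec N) x = algebraMap ℂ _ c := by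
  refine ⟨ExteriorAlgebra.algebraMapInv x, ?_⟩
  have : ExteriorAlgebra.map (0 : Evec N →ₗ[ℂ] Evec N) =
      (Algebra.ofId ℂ (ExtE N)).comp ExteriorAlgebra.algebraMapInv := by
    ext v
    simp [ExteriorAlgebra.algebraMapInv]
  rw [this]
  rfl

theorem eq_smul_wedgeList_finRange {N : ℕ} {x : ExtE N}
    (hx : ∀ i, ExteriorAlgebra.ι ℂ (Pi.single i 1 : Evec N) * x = 0) :
    ∃ c : ℂ, x = c • wedgeList (List.finRange N) := by
  obtain ⟨c, hc⟩ := map_zero_eq_algebraMap (contractList (List.finRange N) x)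
  refine ⟨c, ?_⟩
  rw [eq_wedgeList_mul (List.nodup_finRange N) fun i _ => hx i,
    ← wedgeList_mul_map (p := 0) (fun e i hi => absurd (List.mem_finRange i) hi), hc,
    ← Algebra.commutes, ← Algebra.smul_def]

theorem contractLeft_wedgeList_mul {N : ℕ} {L : List (Fin N)} {d : Module.Dual ℂ (Evec N)}
    (hd : ∀ i ∈ L, d (Pi.single i 1) = 0) (x : ExtE N) :
    contractLeft (Q := (0 : QuadraticForm ℂ (Evec N))) d (wedgeList L * x) =
      (-1 : ℂ) ^ L.length •
        (wedgeList L * contractLeft (Q := (0 : QuadraticForm ℂ (Evec N))) d x) := by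
  induction L with
  | nil => simp [wedgeList_nil]
  | cons i L ih =>
    have h := contractLeft_ι_mul (Q := (0 : QuadraticForm ℂ (Evec N))) (d := d)
      (Pi.single i 1) (wedgeList L * x)
    rw [hd i (by simp), zero_smul, zero_sub, ih fun j hj => hd j (by simp [hj])] at h
    rw [wedgeList_cons, mul_assoc]
    refine h.trans ?_
    rw [List.length_cons, pow_succ, mul_smul_comm, mul_assoc]
    simp

theorem contractList_wedgeList_mul {N : ℕ} {L : List (Fin N)} (hL : L.Nodup) {x : ExtE N}
    (hx : ∀ i ∈ L, contractCoord i x = 0) : contractList L (wedgeList L * x) = x := by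
  induction L with
  | nil => simp [wedgeList_nil, contractList]
  | cons i L ih =>
    obtain ⟨hi, hL⟩ := List.nodup_cons.1 hL
    have h1 : contractCoord i (wedgeList L * x) = 0 := by
      refine (contractLeft_wedgeList_mul (fun j hj => ?_) x).trans ?_
      · exact Pi.single_eq_of_ne (by rintro rfl; exact hi hj) _
      · have := hx i (by simp)
        rw [contractCoord] at this
        rw [this, mul_zero, smul_zero]
    rw [contractList, LinearMap.comp_apply, wedgeList_cons, mul_assoc, contractCoord_ι_mul, h1,
      mul_zero, sub_zero, Pi.single_eq_same, one_smul, ih hL fun j hj => hx j (by simp [hj])]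

theorem contractLeft_map {M N : ℕ} (g : Evec M →ₗ[ℂ] Evec N) (d : Module.Dual ℂ (Evec N))
    (x : ExtE M) :
    contractLeft (Q := (0 : QuadraticForm ℂ (Evec N))) d (ExteriorAlgebra.map g x) =
      ExteriorAlgebra.map g
        (contractLeft (Q := (0 : QuadraticForm ℂ (Evec M))) (d ∘ₗ g) x) := by
  induction x using CliffordAlgebra.left_induction with
  | algebraMap r =>
    rw [contractLeft_algebraMap, map_zero]
    refine Eq.trans (congrArg _ (AlgHom.commutes _ _)) (contractLeft_algebraMap _ _ _)
  | add x y hx hy => simp only [map_add, hx, hy]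
  | ι_mul x m hx =>
    have h1 : ∀ y, ExteriorAlgebra.map g (ι (0 : QuadraticForm ℂ (Evec M)) m * y) =
        ι (0 : QuadraticForm ℂ (Evec N)) (g m) * ExteriorAlgebra.map g y := fun y => by
      rw [map_mul]
      congr 1
      exact ExteriorAlgebra.map_apply_ι g m
    rw [h1, contractLeft_ι_mul, contractLeft_ι_mul, map_sub, map_smul, h1, hx]
    rfl

theorem exists_polarForm_ne_zero {N : ℕ} {K : Submodule ℂ (Vsp N)}
    (hK : ∀ v ∈ K, ∀ w ∈ K, polarForm N v w = 0) (hd : Module.finrank ℂ K = N) {u : Vsp N}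
    (hu : u ∉ K) : ∃ w ∈ K, polarForm N w u ≠ 0 := by
  by_contra! h
  have h1 : K ≤ (polarForm N).orthogonal K := fun v hv w hw => hK w hw v hv
  have h2 : K = (polarForm N).orthogonal K := by
    refine Submodule.eq_of_le_of_finrank_le h1 ?_
    rw [LinearMap.BilinForm.finrank_orthogonal (polarForm_nondegenerate N), hd]
    simp
  refine hu ?_
  rw [h2]
  exact h

/-- For a maximal isotropic subspace `K` and an isotropic vector `u ∉ K`, the maximal isotropic
subspace `(K ∩ u^⊥) + ⟨u⟩`. -/
def adjoinVec {N : ℕ} (K : Submodule ℂ (Vsp N)) (u : Vsp N) : Submodule ℂ (Vsp N) :=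
  (K ⊓ LinearMap.ker (polarForm N u)) ⊔ Submodule.span ℂ {u}

theorem mem_adjoinVec_self {N : ℕ} (K : Submodule ℂ (Vsp N)) (u : Vsp N) : u ∈ adjoinVec K u :=
  le_sup_right (a := K ⊓ LinearMap.ker (polarForm N u)) (Submodule.mem_span_singleton_self u)

theorem adjoinVec_le_ker {N : ℕ} {K : Submodule ℂ (Vsp N)} {u : Vsp N} {x : ExtE N}
    (hK : K ≤ LinearMap.ker (psi x)) (hu : polarForm N u u = 0) :
    adjoinVec K u ≤ LinearMap.ker (psi (psi x u)) := by
  refine sup_le ?_ ?_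
  · rintro w ⟨hw, hwu⟩
    rw [LinearMap.mem_ker, psi_psi_swap u (hK hw), polarForm_symm, LinearMap.mem_ker.1 hwu,
      zero_smul]
  · rw [Submodule.span_singleton_le_iff_mem]
    exact psi_psi_self x hu

theorem le_finrank_adjoinVec {N : ℕ} {K : Submodule ℂ (Vsp N)} {u : Vsp N}
    (hd : Module.finrank ℂ K = N) (hu : u ∉ K) : N ≤ Module.finrank ℂ (adjoinVec K u) := by
  have h1 : K ⊓ LinearMap.ker (polarForm N u) < adjoinVec K u :=
    lt_of_le_of_ne le_sup_left fun h => hu (h.symm ▸ mem_adjoinVec_self K u : u ∈ K ⊓ _).1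
  have h2 := Submodule.finrank_lt_finrank_of_lt h1
  have h3 := finrank_le_inf_ker_add_one K u
  omega

theorem finrank_inf_lt_adjoinVec {N : ℕ} {K F : Submodule ℂ (Vsp N)} {u : Vsp N}
    (hF : ∀ w ∈ F, polarForm N u w = 0) (huF : u ∈ F) (hu : u ∉ K) :
    Module.finrank ℂ (K ⊓ F : Submodule ℂ (Vsp N)) <
      Module.finrank ℂ (adjoinVec K u ⊓ F : Submodule ℂ (Vsp N)) := by
  refine Submodule.finrank_lt_finrank_of_lt (lt_of_le_of_ne ?_ ?_)
  · exact fun w hw => ⟨le_sup_left (a := K ⊓ LinearMap.ker (polarForm N u)) ⟨hw.1, hF w hw.2⟩, hw.2⟩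
  · exact fun h => hu (h.symm ▸ ⟨mem_adjoinVec_self K u, huF⟩ : u ∈ K ⊓ F).1

theorem finrank_ker_psi_psi {N : ℕ} {x : ExtE N}
    (hd : Module.finrank ℂ (LinearMap.ker (psi x)) = N) {u : Vsp N} (hu : psi x u ≠ 0)
    (huu : polarForm N u u = 0) : Module.finrank ℂ (LinearMap.ker (psi (psi x u))) = N :=
  (finrank_ker_psi_le hu).antisymm
    ((le_finrank_adjoinVec hd hu).trans (Submodule.finrank_mono (adjoinVec_le_ker le_rfl huu)))

theorem finrank_inf_lt_ker_psi_psi {N : ℕ} {x : ExtE N} {F : Submodule ℂ (Vsp N)} {u : Vsp N}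
    (hF : ∀ v ∈ F, ∀ w ∈ F, polarForm N v w = 0) (huF : u ∈ F) (hu : psi x u ≠ 0) :
    Module.finrank ℂ (LinearMap.ker (psi x) ⊓ F : Submodule ℂ (Vsp N)) <
      Module.finrank ℂ (LinearMap.ker (psi (psi x u)) ⊓ F : Submodule ℂ (Vsp N)) :=
  (finrank_inf_lt_adjoinVec (hF u huF) huF hu).trans_le
    (Submodule.finrank_mono (inf_le_inf_right _ (adjoinVec_le_ker le_rfl (hF u huF u huF))))

/-- The maximal isotropic subspace `E ⊂ V`. -/
def isotropicE (N : ℕ) : Submodule ℂ (Vsp N) := LinearMap.ker (LinearMap.snd ℂ _ _)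

theorem polarForm_isotropicE {N : ℕ} :
    ∀ v ∈ isotropicE N, ∀ w ∈ isotropicE N, polarForm N v w = 0 := by
  intro v hv w hw
  have hv : v.2 = 0 := hv
  have hw : w.2 = 0 := hw
  simp [polarForm_eq, hv, hw]

theorem ι_single_mul_eq_psi {N : ℕ} (x : ExtE N) (i : Fin N) :
    ExteriorAlgebra.ι ℂ (Pi.single i 1 : Evec N) * x = psi x (Pi.single i 1, 0) := by
  simp [psi_apply]

theorem exists_eq_smul_of_isotropicE_le {N : ℕ} {x y : ExtE N} (hx : x ≠ 0)
    (hEx : isotropicE N ≤ LinearMap.ker (psi x)) (hEy : isotropicE N ≤ LinearMap.ker (psi y)) :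
    ∃ c : ℂ, y = c • x := by
  have key : ∀ {z : ExtE N}, isotropicE N ≤ LinearMap.ker (psi z) →
      ∃ c : ℂ, z = c • wedgeList (List.finRange N) := fun hz =>
    eq_smul_wedgeList_finRange fun i =>
      (ι_single_mul_eq_psi _ i).trans (hz (show ((Pi.single i 1, 0) : Vsp N).2 = 0 from rfl))
  obtain ⟨s, rfl⟩ := key hEx
  obtain ⟨t, rfl⟩ := key hEy
  have hs : s ≠ 0 := by rintro rfl; simp at hx
  exact ⟨t / s, by rw [smul_smul, div_mul_cancel₀ _ hs]⟩

theorem exists_eq_smul_of_le_ker {N : ℕ} {x y : ExtE N} {K : Submodule ℂ (Vsp N)} (hx : x ≠ 0)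
    (hd : Module.finrank ℂ K = N) (hKx : K ≤ LinearMap.ker (psi x))
    (hKy : K ≤ LinearMap.ker (psi y)) : ∃ c : ℂ, y = c • x := by
  obtain ⟨k, hk⟩ : ∃ k, N ≤ Module.finrank ℂ (K ⊓ isotropicE N : Submodule ℂ (Vsp N)) + k :=
    ⟨N, by omega⟩
  induction k generalizing x y K with
  | zero =>
    have hE : K ⊓ isotropicE N = isotropicE N :=
      Submodule.eq_of_le_of_finrank_le inf_le_right
        ((finrank_le_of_isotropic polarForm_isotropicE).trans hk)
    rw [inf_eq_right] at hE
    exact exists_eq_smul_of_isotropicE_le hx (hE.trans hKx) (hE.trans hKy)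
  | succ k ih =>
    by_cases hE : isotropicE N ≤ K
    · exact exists_eq_smul_of_isotropicE_le hx (hE.trans hKx) (hE.trans hKy)
    · obtain ⟨u, huE, huK⟩ := SetLike.not_le_iff_exists.1 hE
      have hKeq : K = LinearMap.ker (psi x) :=
        Submodule.eq_of_le_of_finrank_le hKx (hd.symm ▸ finrank_ker_psi_le hx)
      have hu : psi x u ≠ 0 := fun h => huK (hKeq ▸ h)
      have huu := polarForm_isotropicE u huE u huE
      have hle := adjoinVec_le_ker hKx huu
      have hlt := finrank_inf_lt_adjoinVec (polarForm_isotropicE u huE) huE huK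
      obtain ⟨c, hc⟩ := ih hu
        (((Submodule.finrank_mono hle).trans (finrank_ker_psi_le hu)).antisymm
          (le_finrank_adjoinVec hd huK)) hle (adjoinVec_le_ker hKy huu) (by omega)
      obtain ⟨w, hw, hwu⟩ := exists_polarForm_ne_zero
        (fun v hv w hw => polarForm_eq_zero_of_mem_ker hx (hKx hv) (hKx hw)) hd huK
      refine ⟨c, ?_⟩
      have h1 := psi_psi_swap u (hKy hw)
      rw [hc, psi_smul, psi_psi_swap u (hKx hw), smul_comm] at h1
      exact (smul_right_injective _ hwu h1).symm

theorem mk_eq_mk_of_ker_le {N : ℕ} {a b : ExtE N} (ha : purespinor a) (hb : purespinor b)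
    (h : LinearMap.ker (psi a) ≤ LinearMap.ker (psi b)) :
    Projectivization.mk ℂ a ha.1 = Projectivization.mk ℂ b hb.1 := by
  obtain ⟨c, hc⟩ := exists_eq_smul_of_le_ker ha.1 ha.2.2 le_rfl h
  rw [eq_comm, Projectivization.mk_eq_mk_iff']
  exact ⟨c, hc.symm⟩

theorem purespinor_smul {N : ℕ} {a : ExtE N} (ha : purespinor a) {c : ℂ} (hc : c ≠ 0) :
    purespinor (c • a) :=
  ⟨smul_ne_zero hc ha.1, Submodule.smul_mem _ _ ha.2.1, by rw [ker_psi_smul hc]; exact ha.2.2⟩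

theorem mk_mem_SpinorVariety_iff {N : ℕ} {a : ExtE N} (h : a ≠ 0) :
    Projectivization.mk ℂ a h ∈ SpinorVariety N ↔ purespinor a := by
  refine ⟨?_, fun ha => ⟨a, h, ha, rfl⟩⟩
  rintro ⟨b, hb, hpb, hab⟩
  obtain ⟨c, rfl⟩ := (Projectivization.mk_eq_mk_iff' ..).1 hab
  exact purespinor_smul hpb (by rintro rfl; simp at h)

theorem psi_add_smul_psi_psi_apply {N : ℕ} {a : ExtE N} {u v w : Vsp N}
    (huu : polarForm N u u = 0) (hvv : polarForm N v v = 0) (huv : polarForm N u v = 0) (t : ℂ)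
    (hw : psi a w = 0) :
    psi (a + t • psi (psi a u) v)
      (w + t • (polarForm N w u • v - polarForm N w v • u)) = 0 := by
  have h1 : psi (psi a w) v = 0 := by rw [hw, psi_zero]
  have h2 : psi (psi a u) w = polarForm N w u • a := psi_psi_swap u hw
  have h3 : psi (psi (psi a u) v) v = 0 := psi_psi_self _ hvv
  have h4 : psi (psi (psi a u) v) u = 0 := by
    have := psi_psi_add_swap (psi a u) u v
    rwa [psi_psi_self a huu, psi_zero, add_zero, huv, zero_smul] at this
  have h5 : psi (psi (psi a u) v) w =
      polarForm N w v • psi a u - polarForm N w u • psi a v := by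
    rw [← psi_psi_add_swap (psi a u) w v, h2, psi_smul]
    abel
  simp only [psi_add, psi_smul, map_add, map_smul, map_sub, hw, h3, h4, h5]
  module

theorem purespinor_add_smul_psi_psi {N : ℕ} {a : ExtE N} (ha : purespinor a) {u v : Vsp N}
    (huu : polarForm N u u = 0) (hvv : polarForm N v v = 0) (huv : polarForm N u v = 0) (t : ℂ)
    (hne : a + t • psi (psi a u) v ≠ 0) : purespinor (a + t • psi (psi a u) v) := by
  refine ⟨hne, add_mem ha.2.1 (Submodule.smul_mem _ _ (psi_psi_mem_evenPart u v ha.2.1)),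
    (finrank_ker_psi_le hne).antisymm ?_⟩
  let g : Vsp N →ₗ[ℂ] Vsp N := LinearMap.id +
    t • (((polarForm N).flip u).smulRight v - ((polarForm N).flip v).smulRight u)
  have hg : ∀ w, g w = w + t • (polarForm N w u • v - polarForm N w v • u) := fun w => rfl
  have hinj : Function.Injective g := by
    rw [injective_iff_map_eq_zero]
    intro w hw
    rw [hg] at hw
    have h1 := congrArg (fun z => polarForm N z u) hw
    have h2 := congrArg (fun z => polarForm N z v) hw
    simp [huu, hvv, huv, (polarForm_symm v u).trans huv] at h1 h2
    simpa [h1, h2] using hw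
  calc N = Module.finrank ℂ (LinearMap.ker (psi a)) := ha.2.2.symm
    _ = Module.finrank ℂ ((LinearMap.ker (psi a)).map g) :=
      (Submodule.equivMapOfInjective g hinj _).finrank_eq
    _ ≤ _ := Submodule.finrank_mono (Submodule.map_le_iff_le_comap.2 fun w hw => by
      rw [Submodule.mem_comap, hg]
      exact psi_add_smul_psi_psi_apply huu hvv huv t hw)

theorem lineIn_self {K V : Type*} [DivisionRing K] [AddCommGroup V] [Module K V]
    {X : Set (Projectivization K V)} {p : Projectivization K V} (hp : p ∈ X) : lineIn X p p := by
  intro r hr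
  rw [sup_idem] at hr
  have : r = p := Projectivization.submodule_injective
    (Submodule.eq_of_le_of_finrank_eq hr (by simp only [Projectivization.finrank_submodule]))
  rwa [this]

theorem chainDist_self {K V : Type*} [DivisionRing K] [AddCommGroup V] [Module K V]
    {X : Set (Projectivization K V)} {p : Projectivization K V} (hp : p ∈ X) (k : ℕ) :
    chainDist X p p k :=
  ⟨fun _ => p, rfl, rfl, fun _ _ => hp, fun _ _ => lineIn_self hp⟩

theorem chainDist_succ {K V : Type*} [DivisionRing K] [AddCommGroup V] [Module K V]
    {X : Set (Projectivization K V)} {p q r : Projectivization K V} {k : ℕ} (hp : p ∈ X)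
    (hpq : lineIn X p q) (hqr : chainDist X q r k) : chainDist X p r (k + 1) := by
  obtain ⟨c, h0, hk, hX, hl⟩ := hqr
  refine ⟨fun i => Nat.casesOn i p c, rfl, hk, ?_, ?_⟩
  · rintro (_ | i) hi
    · exact hp
    · exact hX i (by omega)
  · rintro (_ | i) hi
    · change lineIn X p (c 0)
      rwa [h0]
    · exact hl i (by omega)

theorem lineIn_psi_psi {N : ℕ} {a : ExtE N} (ha : purespinor a) {u v : Vsp N}
    (huu : polarForm N u u = 0) (hvv : polarForm N v v = 0) (huv : polarForm N u v = 0)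
    (hc : purespinor (psi (psi a u) v)) :
    lineIn (SpinorVariety N) (Projectivization.mk ℂ a ha.1) (Projectivization.mk ℂ _ hc.1) := by
  intro r hr
  induction r using Projectivization.ind with
  | h z hz =>
    rw [Projectivization.submodule_mk, Projectivization.submodule_mk, Projectivization.submodule_mk,
      Submodule.span_singleton_le_iff_mem, Submodule.mem_sup] at hr
    obtain ⟨y, hy, y', hy', rfl⟩ := hr
    obtain ⟨s, rfl⟩ := Submodule.mem_span_singleton.1 hy
    obtain ⟨t, rfl⟩ := Submodule.mem_span_singleton.1 hy'
    rw [mk_mem_SpinorVariety_iff]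
    by_cases hs : s = 0
    · subst hs
      rw [zero_smul, zero_add] at hz ⊢
      exact purespinor_smul hc (by rintro rfl; simp at hz)
    · have h : s • a + t • psi (psi a u) v = s • (a + (t / s) • psi (psi a u) v) := by
        rw [smul_add, smul_smul, mul_div_cancel₀ _ hs]
      rw [h] at hz ⊢
      exact purespinor_smul
        (purespinor_add_smul_psi_psi ha huu hvv huv _ (right_ne_zero_of_smul hz)) hs

theorem not_ker_le_ker_psi_psi {N : ℕ} {a b : ExtE N} (ha : purespinor a) (hb : purespinor b)
    {u : Vsp N} (hu : psi a u ≠ 0) :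
    ¬LinearMap.ker (psi b) ≤ LinearMap.ker (psi (psi a u)) := by
  intro h
  obtain ⟨c, hc⟩ := exists_eq_smul_of_le_ker hb.1 hb.2.2 le_rfl h
  have h0 : psi a u ∈ evenPart N := hc ▸ Submodule.smul_mem _ _ hb.2.1
  have h1 : psi a u ∈ oddPart N := psi_mem_evenOdd (i := 0) u ha.2.1
  exact hu (Submodule.disjoint_def.1
    (evenOdd_isCompl (0 : QuadraticForm ℂ (Evec N))).disjoint _ h0 h1)

theorem eq_or_exists_lineIn {N : ℕ} {a b : ExtE N} (ha : purespinor a) (hb : purespinor b) :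
    Projectivization.mk ℂ a ha.1 = Projectivization.mk ℂ b hb.1 ∨
    ∃ (c : ExtE N) (hc : purespinor c),
      lineIn (SpinorVariety N) (Projectivization.mk ℂ a ha.1) (Projectivization.mk ℂ c hc.1) ∧
      Module.finrank ℂ (LinearMap.ker (psi a) ⊓ LinearMap.ker (psi b) : Submodule ℂ (Vsp N)) + 2 ≤
        Module.finrank ℂ (LinearMap.ker (psi c) ⊓ LinearMap.ker (psi b) : Submodule ℂ (Vsp N)) := by
  by_cases hba : LinearMap.ker (psi b) ≤ LinearMap.ker (psi a)
  · exact Or.inl (mk_eq_mk_of_ker_le hb ha hba).symm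
  right
  have hF : ∀ v ∈ LinearMap.ker (psi b), ∀ w ∈ LinearMap.ker (psi b), polarForm N v w = 0 :=
    fun v hv w hw => polarForm_eq_zero_of_mem_ker hb.1 hv hw
  obtain ⟨u, hub, hua⟩ := SetLike.not_le_iff_exists.1 hba
  have hua : psi a u ≠ 0 := hua
  obtain ⟨v, hvb, hva⟩ := SetLike.not_le_iff_exists.1 (not_ker_le_ker_psi_psi ha hb hua)
  have hva : psi (psi a u) v ≠ 0 := hva
  have hc : purespinor (psi (psi a u) v) :=
    ⟨hva, psi_psi_mem_evenPart u v ha.2.1, finrank_ker_psi_psi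
      (finrank_ker_psi_psi ha.2.2 hua (hF u hub u hub)) hva (hF v hvb v hvb)⟩
  refine ⟨_, hc, lineIn_psi_psi ha (hF u hub u hub) (hF v hvb v hvb) (hF u hub v hvb) hc, ?_⟩
  have h1 := finrank_inf_lt_ker_psi_psi hF hub hua
  have h2 := finrank_inf_lt_ker_psi_psi hF hvb hva
  omega

theorem chainDist_of_le_finrank {N : ℕ} {a b : ExtE N} (ha : purespinor a) (hb : purespinor b)
    (k : ℕ) (h : N ≤ Module.finrank ℂ
      (LinearMap.ker (psi a) ⊓ LinearMap.ker (psi b) : Submodule ℂ (Vsp N)) + 2 * k + 1) :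
    chainDist (SpinorVariety N) (Projectivization.mk ℂ a ha.1)
      (Projectivization.mk ℂ b hb.1) k := by
  have haX := (mk_mem_SpinorVariety_iff ha.1).2 ha
  induction k generalizing a with
  | zero =>
    rcases eq_or_exists_lineIn ha hb with he | ⟨c, hc, -, hcd⟩
    · rw [← he]; exact chainDist_self haX _
    · have := Submodule.finrank_mono
        (inf_le_right : LinearMap.ker (psi c) ⊓ LinearMap.ker (psi b) ≤ LinearMap.ker (psi b))
      rw [hb.2.2] at this
      omega
  | succ k ih =>
    rcases eq_or_exists_lineIn ha hb with he | ⟨c, hc, hl, hcd⟩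
    · rw [← he]; exact chainDist_self haX _
    · exact chainDist_succ haX hl (ih hc (by omega) ((mk_mem_SpinorVariety_iff hc.1).2 hc))

theorem le_finrank_inf_of_lineIn {N : ℕ} {a b : ExtE N} (ha : purespinor a) (hb : purespinor b)
    (h : lineIn (SpinorVariety N) (Projectivization.mk ℂ a ha.1) (Projectivization.mk ℂ b hb.1)) :
    N ≤ Module.finrank ℂ
      (LinearMap.ker (psi a) ⊓ LinearMap.ker (psi b) : Submodule ℂ (Vsp N)) + 2 := by
  by_cases hle : LinearMap.ker (psi a) ≤ LinearMap.ker (psi b)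
  · rw [inf_eq_left.2 hle, ha.2.2]
    omega
  have hab : a + b ≠ 0 := by
    intro h0
    refine hle fun v hv => ?_
    have hv : psi a v = 0 := hv
    rw [LinearMap.mem_ker, eq_neg_of_add_eq_zero_right h0, psi_neg, hv, neg_zero]
  have hp : purespinor (a + b) := by
    rw [← mk_mem_SpinorVariety_iff hab]
    refine h _ ?_
    simp only [Projectivization.submodule_mk]
    rw [Submodule.span_singleton_le_iff_mem]
    exact Submodule.add_mem_sup (Submodule.mem_span_singleton_self a)
      (Submodule.mem_span_singleton_self b)
  obtain ⟨v, hv, hva⟩ : ∃ v, psi (a + b) v = 0 ∧ psi a v ≠ 0 := by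
    by_contra! hc
    have hle' : LinearMap.ker (psi (a + b)) ≤ LinearMap.ker (psi a) := fun v hv => hc v hv
    refine hle fun v hv => ?_
    have hv' : psi (a + b) v = 0 :=
      (Submodule.eq_of_le_of_finrank_eq hle' (by rw [ha.2.2, hp.2.2])).ge hv
    rwa [psi_add, LinearMap.mem_ker.1 hv, zero_add] at hv'
  have hvb : psi b v = -psi a v := by
    rw [psi_add] at hv
    exact eq_neg_of_add_eq_zero_right hv
  let A := LinearMap.ker (psi a) ⊓ LinearMap.ker (polarForm N v)
  let B := LinearMap.ker (psi b) ⊓ LinearMap.ker (polarForm N v)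
  have hAB : A ⊔ B ≤ LinearMap.ker (psi (psi a v)) := by
    refine sup_le ?_ ?_ <;> rintro w ⟨hw, hwv⟩
    · rw [LinearMap.mem_ker, psi_psi_swap v hw, polarForm_symm, LinearMap.mem_ker.1 hwv, zero_smul]
    · rw [LinearMap.mem_ker, ← neg_neg (psi a v), ← hvb, psi_neg, psi_psi_swap v hw,
        polarForm_symm, LinearMap.mem_ker.1 hwv, zero_smul, neg_zero]
  have h1 := (Submodule.finrank_mono hAB).trans (finrank_ker_psi_le hva)
  have h2 := Submodule.finrank_sup_add_finrank_inf_eq A B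
  have h3 := Submodule.finrank_mono (inf_le_inf inf_le_left inf_le_left :
    A ⊓ B ≤ LinearMap.ker (psi a) ⊓ LinearMap.ker (psi b))
  have h4 := finrank_le_inf_ker_add_one (LinearMap.ker (psi a)) v
  have h5 := finrank_le_inf_ker_add_one (LinearMap.ker (psi b)) v
  rw [ha.2.2] at h4
  rw [hb.2.2] at h5
  change N ≤ Module.finrank ℂ A + 1 at h4
  change N ≤ Module.finrank ℂ B + 1 at h5
  omega

theorem le_finrank_inf_of_chainDist {N : ℕ} {a b : ExtE N} (ha : purespinor a)
    (hb : purespinor b) {k : ℕ}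
    (h : chainDist (SpinorVariety N) (Projectivization.mk ℂ a ha.1)
      (Projectivization.mk ℂ b hb.1) k) :
    N ≤ Module.finrank ℂ
      (LinearMap.ker (psi a) ⊓ LinearMap.ker (psi b) : Submodule ℂ (Vsp N)) + 2 * k := by
  obtain ⟨c, h0, hk, hX, hl⟩ := h
  induction k generalizing b with
  | zero =>
    obtain ⟨s, hs⟩ := (Projectivization.mk_eq_mk_iff' ..).1 (h0.symm.trans hk)
    have hs0 : s ≠ 0 := by rintro rfl; exact ha.1 (by rw [← hs, zero_smul])
    rw [← hs, ker_psi_smul hs0, inf_idem, hb.2.2]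
    omega
  | succ k ih =>
    obtain ⟨d, _, hd, hcd⟩ := hX k (by omega)
    have h1 := ih hd hcd (fun i hi => hX i (by omega)) fun i hi => hl i (by omega)
    have h2 := hl k (by omega)
    rw [hcd, hk] at h2
    have h3 := le_finrank_inf_of_lineIn hd hb h2
    have h4 := Submodule.finrank_sup_add_finrank_inf_eq
      (LinearMap.ker (psi a) ⊓ LinearMap.ker (psi d))
      (LinearMap.ker (psi d) ⊓ LinearMap.ker (psi b))
    have h5 := Submodule.finrank_mono (sup_le inf_le_right inf_le_left :
      (LinearMap.ker (psi a) ⊓ LinearMap.ker (psi d)) ⊔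
        (LinearMap.ker (psi d) ⊓ LinearMap.ker (psi b)) ≤ LinearMap.ker (psi d))
    have h6 := Submodule.finrank_mono (inf_le_inf inf_le_left inf_le_right :
      (LinearMap.ker (psi a) ⊓ LinearMap.ker (psi d)) ⊓
        (LinearMap.ker (psi d) ⊓ LinearMap.ker (psi b)) ≤
          LinearMap.ker (psi a) ⊓ LinearMap.ker (psi b))
    rw [hd.2.2] at h5
    omega

/-- The Hamming distance between two pure spinors is half the codimension of the intersection of
their annihilators. -/
theorem hdist_eq_of_finrank {N : ℕ} {a b : ExtE N} (ha : purespinor a) (hb : purespinor b)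
    {k : ℕ} (h : Module.finrank ℂ
      (LinearMap.ker (psi a) ⊓ LinearMap.ker (psi b) : Submodule ℂ (Vsp N)) + 2 * k = N) :
    hdist (SpinorVariety N) (Projectivization.mk ℂ a ha.1) (Projectivization.mk ℂ b hb.1) = k := by
  have hk := chainDist_of_le_finrank ha hb k (by omega)
  refine le_antisymm (Nat.sInf_le hk) (le_csInf ⟨k, hk⟩ fun r hr => ?_)
  have := le_finrank_inf_of_chainDist ha hb hr
  omega

theorem ker_inf_ker_eq_bot_of_hdist {l : ℕ} (hl : 1 ≤ l) {a b : ExtE (2 * l)} (ha : purespinor a)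
    (hb : purespinor b)
    (h : hdist (SpinorVariety (2 * l)) (Projectivization.mk ℂ a ha.1)
      (Projectivization.mk ℂ b hb.1) = l) :
    LinearMap.ker (psi a) ⊓ LinearMap.ker (psi b) = ⊥ := by
  rw [← Submodule.finrank_eq_zero (R := ℂ)]
  by_contra h0
  have : hdist (SpinorVariety (2 * l)) _ _ ≤ l - 1 :=
    Nat.sInf_le (chainDist_of_le_finrank ha hb (l - 1) (by omega))
  omega

/-- The list of the first `N - 2l` indices of `Fin N`. -/
def frontList (N l : ℕ) : List (Fin N) :=
  (Finset.univ.filter fun k : Fin N => k.1 < N - 2 * l).sort (· ≤ ·)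

theorem mem_frontList {N l : ℕ} {i : Fin N} : i ∈ frontList N l ↔ i.1 < N - 2 * l := by
  simp [frontList]

theorem nodup_frontList (N l : ℕ) : (frontList N l).Nodup := Finset.sort_nodup _ _

theorem length_frontList (N l : ℕ) : (frontList N l).length = N - 2 * l := by
  rw [frontList, Finset.length_sort, Fin.card_filter_val_lt]
  omega

theorem even_length_frontList {N : ℕ} (hN : Even N) (l : ℕ) : Even (frontList N l).length := by
  rw [length_frontList]
  exact hN.tsub (even_two_mul l)

/-- Restriction of vectors of `ℂ^N` to their last `2l` coordinates. -/
def restrictMap (N l : ℕ) (h : 2 * l ≤ N) : Evec N →ₗ[ℂ] Evec (2 * l) :=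
  LinearMap.funLeft ℂ ℂ fun j : Fin (2 * l) => ⟨j.1 + (N - 2 * l), by omega⟩

theorem restrictMap_padMap {N l : ℕ} (h : 2 * l ≤ N) (e : Evec (2 * l)) :
    restrictMap N l h (padMap N l h e) = e := by
  funext j
  simp only [restrictMap, padMap, LinearMap.coe_mk, AddHom.coe_mk, LinearMap.funLeft_apply,
    Nat.le_add_left, dif_pos, Nat.add_sub_cancel]

theorem padMap_apply_of_mem {N l : ℕ} (h : 2 * l ≤ N) (e : Evec (2 * l)) {i : Fin N}
    (hi : i ∈ frontList N l) : padMap N l h e i = 0 := by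
  rw [mem_frontList] at hi
  exact dif_neg (not_le.2 hi)

theorem padMap_restrictMap {N l : ℕ} (h : 2 * l ≤ N) (e : Evec N) {i : Fin N}
    (hi : i ∉ frontList N l) : padMap N l h (restrictMap N l h e) i = e i := by
  rw [mem_frontList, not_lt] at hi
  simp only [padMap, restrictMap, LinearMap.coe_mk, AddHom.coe_mk, dif_pos hi,
    LinearMap.funLeft_apply]
  congr 1
  exact Fin.ext (Nat.sub_add_cancel hi)

theorem toDualMap_comp_padMap {N l : ℕ} (h : 2 * l ≤ N) (f : Evec N) :
    toDualMap N f ∘ₗ padMap N l h = toDualMap (2 * l) (restrictMap N l h f) := by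
  ext j
  have hj : padMap N l h (Pi.single j 1) =
      Pi.single (⟨j.1 + (N - 2 * l), by omega⟩ : Fin N) 1 := by
    funext k
    simp only [padMap, LinearMap.coe_mk, AddHom.coe_mk, Pi.single_apply, Fin.ext_iff]
    split_ifs <;> first | rfl | omega
  simp [toDualMap_apply, hj, Pi.single_apply, restrictMap, LinearMap.funLeft_apply]

/-- Restriction to the last `2l` coordinates on both summands of `V = E ⊕ E^∨`. -/
def restrictPair (N l : ℕ) (h : 2 * l ≤ N) : Vsp N →ₗ[ℂ] Vsp (2 * l) :=
  (restrictMap N l h).prodMap (restrictMap N l h)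

/-- The linear map `w ↦ e_{[N-2l]} ∧ w`. -/
def wedgeFront (N l : ℕ) (h : 2 * l ≤ N) : ExtE (2 * l) →ₗ[ℂ] ExtE N :=
  (LinearMap.mulLeft ℂ (wedgeList (frontList N l))).comp
    (ExteriorAlgebra.map (padMap N l h)).toLinearMap

theorem wedgeFront_apply {N l : ℕ} (h : 2 * l ≤ N) (y : ExtE (2 * l)) :
    wedgeFront N l h y =
      wedgeList (frontList N l) * ExteriorAlgebra.map (padMap N l h) y := rfl

theorem map_restrictMap_map_padMap {N l : ℕ} (h : 2 * l ≤ N) (y : ExtE (2 * l)) :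
    ExteriorAlgebra.map (restrictMap N l h) (ExteriorAlgebra.map (padMap N l h) y) = y := by
  have h1 : restrictMap N l h ∘ₗ padMap N l h = LinearMap.id :=
    LinearMap.ext (restrictMap_padMap h)
  rw [← AlgHom.comp_apply, ExteriorAlgebra.map_comp_map, h1, ExteriorAlgebra.map_id]
  rfl

theorem wedgeFront_injective {N l : ℕ} (h : 2 * l ≤ N) :
    Function.Injective (wedgeFront N l h) := by
  refine Function.LeftInverse.injective (g := fun x =>
    ExteriorAlgebra.map (restrictMap N l h) (contractList (frontList N l) x)) fun y => ?_
  simp only [wedgeFront_apply]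
  rw [contractList_wedgeList_mul (nodup_frontList N l), map_restrictMap_map_padMap]
  intro i hi
  have hz : LinearMap.proj i ∘ₗ padMap N l h = 0 :=
    LinearMap.ext fun e => padMap_apply_of_mem h e hi
  rw [contractCoord, contractLeft_map, hz]
  simp

theorem exists_eq_wedgeFront {N l : ℕ} (h : 2 * l ≤ N) {x : ExtE N}
    (hx : ∀ i : Fin N, i.1 < N - 2 * l → psi x (Pi.single i 1, 0) = 0) :
    ∃ y, x = wedgeFront N l h y := by
  refine ⟨ExteriorAlgebra.map (restrictMap N l h) (contractList (frontList N l) x), ?_⟩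
  rw [wedgeFront_apply, ← AlgHom.comp_apply, ExteriorAlgebra.map_comp_map,
    wedgeList_mul_map fun e i hi => padMap_restrictMap h e hi]
  exact eq_wedgeList_mul (nodup_frontList N l) fun i hi =>
    (ι_single_mul_eq_psi x i).trans (hx i (mem_frontList.1 hi))

theorem psi_wedgeFront_single {N l : ℕ} (h : 2 * l ≤ N) (y : ExtE (2 * l)) {i : Fin N}
    (hi : i.1 < N - 2 * l) : psi (wedgeFront N l h y) (Pi.single i 1, 0) = 0 := by
  rw [← ι_single_mul_eq_psi, wedgeFront_apply, ← mul_assoc,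
    ι_mul_wedgeList_of_mem (mem_frontList.2 hi), zero_mul]

theorem psi_wedgeFront {N l : ℕ} (hN : Even N) (h : 2 * l ≤ N) (y : ExtE (2 * l)) {v : Vsp N}
    (hv : ∀ i : Fin N, i.1 < N - 2 * l → v.2 i = 0) :
    psi (wedgeFront N l h y) v = wedgeFront N l h (psi y (restrictPair N l h v)) := by
  have h1 : ExteriorAlgebra.ι ℂ v.1 * wedgeList (frontList N l) =
      wedgeList (frontList N l) *
        ExteriorAlgebra.ι ℂ (padMap N l h (restrictMap N l h v.1)) := by
    rw [wedgeList_mul_ι_congr fun i hi => padMap_restrictMap h v.1 hi, wedgeList_mul_ι,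
      (even_length_frontList hN l).neg_one_pow, one_smul]
  have h2 : ∀ i ∈ frontList N l, toDualMap N v.2 (Pi.single i 1) = 0 := fun i hi => by
    simp [toDualMap_apply, Pi.single_apply, hv i (mem_frontList.1 hi)]
  rw [psi_apply, psi_apply, map_add, wedgeFront_apply, wedgeFront_apply, wedgeFront_apply,
    contractLeft_wedgeList_mul h2, (even_length_frontList hN l).neg_one_pow, one_smul,
    contractLeft_map, toDualMap_comp_padMap, map_mul, ExteriorAlgebra.map_apply_ι, ← mul_assoc,
    ← mul_assoc, h1]
  rfl

theorem mem_ker_psi_wedgeFront {N l : ℕ} (hN : Even N) (h : 2 * l ≤ N) {y : ExtE (2 * l)}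
    (hy : y ≠ 0) {v : Vsp N} :
    v ∈ LinearMap.ker (psi (wedgeFront N l h y)) ↔
      (∀ i : Fin N, i.1 < N - 2 * l → v.2 i = 0) ∧
        restrictPair N l h v ∈ LinearMap.ker (psi y) := by
  have hinj := wedgeFront_injective h
  have hne : wedgeFront N l h y ≠ 0 := (map_ne_zero_iff _ hinj).2 hy
  constructor
  · intro hv
    have hv2 : ∀ i : Fin N, i.1 < N - 2 * l → v.2 i = 0 := fun i hi => by
      rw [← polarForm_single_left]
      exact polarForm_eq_zero_of_mem_ker hne (psi_wedgeFront_single h y hi) hv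
    refine ⟨hv2, ?_⟩
    rwa [LinearMap.mem_ker, psi_wedgeFront hN h y hv2, map_eq_zero_iff _ hinj] at hv
  · rintro ⟨hv2, hv⟩
    rw [LinearMap.mem_ker, psi_wedgeFront hN h y hv2, LinearMap.mem_ker.1 hv, map_zero]

/-- The subspace `span(e_1,…,e_{N-2l})` of `V`. -/
def frontSpan (N l : ℕ) : Submodule ℂ (Vsp N) :=
  Submodule.span ℂ {v : Vsp N | ∃ i : Fin N, i.1 < N - 2 * l ∧ v = (Pi.single i 1, 0)}

theorem mem_frontSpan {N l : ℕ} (h : 2 * l ≤ N) {v : Vsp N} :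
    v ∈ frontSpan N l ↔
      (∀ i : Fin N, i.1 < N - 2 * l → v.2 i = 0) ∧ restrictPair N l h v = 0 := by
  constructor
  · intro hv
    induction hv using Submodule.span_induction with
    | mem v hv =>
      obtain ⟨i, hi, rfl⟩ := hv
      refine ⟨fun _ _ => rfl, Prod.ext (funext fun j => ?_) rfl⟩
      exact Pi.single_eq_of_ne (by rw [Ne, Fin.ext_iff]; simp; omega) _
    | zero => simp
    | add v w _ _ hv hw =>
      exact ⟨fun i hi => by simp [hv.1 i hi, hw.1 i hi], by rw [map_add, hv.2, hw.2, add_zero]⟩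
    | smul c v _ hv => exact ⟨fun i hi => by simp [hv.1 i hi], by rw [map_smul, hv.2, smul_zero]⟩
  · rintro ⟨hv2, hv⟩
    have hzero : ∀ e : Evec N, restrictMap N l h e = 0 → ∀ i : Fin N, N - 2 * l ≤ i.1 →
        e i = 0 := fun e he i hi => by
      rw [← padMap_restrictMap h e (by rw [mem_frontList]; omega), he, map_zero]; rfl
    have h1 := hzero v.1 (congrArg Prod.fst hv)
    have h2 : v.2 = 0 := funext fun i => by
      rcases lt_or_ge i.1 (N - 2 * l) with hi | hi
      · exact hv2 i hi
      · exact hzero v.2 (congrArg Prod.snd hv) i hi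
    have h3 : v = ∑ i, v.1 i • ((Pi.single i 1, 0) : Vsp N) := by
      refine Prod.ext (funext fun j => ?_) ?_
      · simp [Prod.fst_sum, Finset.sum_apply, Pi.single_apply]
      · simp [Prod.snd_sum, h2]
    rw [h3]
    refine Submodule.sum_mem _ fun i _ => ?_
    rcases lt_or_ge i.1 (N - 2 * l) with hi | hi
    · exact Submodule.smul_mem _ _ (Submodule.subset_span ⟨i, hi, rfl⟩)
    · rw [h1 i hi, zero_smul]
      exact zero_mem _

theorem finrank_frontSpan (N l : ℕ) : Module.finrank ℂ (frontSpan N l) = N - 2 * l := by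
  have hli : LinearIndependent ℂ
      fun i : {i : Fin N // i.1 < N - 2 * l} => ((Pi.single i.1 1, 0) : Vsp N) := by
    have h1 := (Pi.linearIndependent_single_one (Fin N) ℂ).map' (LinearMap.inl ℂ (Evec N) (Evec N))
      (LinearMap.ker_eq_bot.2 LinearMap.inl_injective)
    exact h1.comp _ Subtype.val_injective
  have hset : {v : Vsp N | ∃ i : Fin N, i.1 < N - 2 * l ∧ v = (Pi.single i 1, 0)} =
      Set.range fun i : {i : Fin N // i.1 < N - 2 * l} => ((Pi.single i.1 1, 0) : Vsp N) := by
    ext v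
    simp [eq_comm]
  rw [frontSpan, hset, finrank_span_eq_card hli, Fintype.card_subtype, Fin.card_filter_val_lt]
  omega

theorem restrictPair_surjOn {N l : ℕ} (h : 2 * l ≤ N) (w : Vsp (2 * l)) :
    ∃ v : Vsp N, (∀ i : Fin N, i.1 < N - 2 * l → v.2 i = 0) ∧ restrictPair N l h v = w :=
  ⟨(padMap N l h w.1, padMap N l h w.2),
    fun _ hi => padMap_apply_of_mem h _ (mem_frontList.2 hi),
    Prod.ext (restrictMap_padMap h w.1) (restrictMap_padMap h w.2)⟩

theorem finrank_ker_psi_wedgeFront {N l : ℕ} (hN : Even N) (h : 2 * l ≤ N) {y : ExtE (2 * l)}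
    (hy : y ≠ 0) :
    Module.finrank ℂ (LinearMap.ker (psi (wedgeFront N l h y))) =
      Module.finrank ℂ (LinearMap.ker (psi y)) + (N - 2 * l) := by
  let K := LinearMap.ker (psi (wedgeFront N l h y))
  have h1 := LinearMap.finrank_range_add_finrank_ker ((restrictPair N l h).domRestrict K)
  have h2 : LinearMap.range ((restrictPair N l h).domRestrict K) = LinearMap.ker (psi y) := by
    ext w
    constructor
    · rintro ⟨v, rfl⟩
      exact ((mem_ker_psi_wedgeFront hN h hy).1 v.2).2
    · intro hw
      obtain ⟨v, hv, rfl⟩ := restrictPair_surjOn h w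
      exact ⟨⟨v, (mem_ker_psi_wedgeFront hN h hy).2 ⟨hv, hw⟩⟩, rfl⟩
  have h3 : (LinearMap.ker ((restrictPair N l h).domRestrict K)).map K.subtype =
      frontSpan N l := by
    ext v
    rw [mem_frontSpan h]
    constructor
    · rintro ⟨v, hv, rfl⟩
      exact ⟨((mem_ker_psi_wedgeFront hN h hy).1 v.2).1, hv⟩
    · rintro ⟨hv, hv0⟩
      exact ⟨⟨v, (mem_ker_psi_wedgeFront hN h hy).2 ⟨hv, hv0 ▸ zero_mem _⟩⟩, hv0, rfl⟩
  rw [h2, ← Submodule.finrank_map_subtype_eq K, h3, finrank_frontSpan] at h1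
  exact h1.symm

theorem ker_inf_ker_wedgeFront_iff {N l : ℕ} (hN : Even N) (h : 2 * l ≤ N) {a b : ExtE (2 * l)}
    (ha : a ≠ 0) (hb : b ≠ 0) :
    LinearMap.ker (psi (wedgeFront N l h a)) ⊓ LinearMap.ker (psi (wedgeFront N l h b)) =
      frontSpan N l ↔ LinearMap.ker (psi a) ⊓ LinearMap.ker (psi b) = ⊥ := by
  constructor
  · intro hab
    rw [eq_bot_iff]
    rintro w ⟨hwa, hwb⟩
    obtain ⟨v, hv, rfl⟩ := restrictPair_surjOn h w
    exact ((mem_frontSpan h).1 (hab.le ⟨(mem_ker_psi_wedgeFront hN h ha).2 ⟨hv, hwa⟩,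
      (mem_ker_psi_wedgeFront hN h hb).2 ⟨hv, hwb⟩⟩)).2
  · intro hab
    ext v
    rw [Submodule.mem_inf, mem_ker_psi_wedgeFront hN h ha, mem_ker_psi_wedgeFront hN h hb,
      mem_frontSpan h, ← Submodule.mem_bot ℂ, ← hab, Submodule.mem_inf]
    tauto

theorem map_mem_evenOdd {M N : ℕ} (g : Evec M →ₗ[ℂ] Evec N) {i : ZMod 2} {x : ExtE M}
    (hx : x ∈ evenOdd (0 : QuadraticForm ℂ (Evec M)) i) :
    ExteriorAlgebra.map g x ∈ evenOdd (0 : QuadraticForm ℂ (Evec N)) i := by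
  have hι : ∀ m, ExteriorAlgebra.map g (ι (0 : QuadraticForm ℂ (Evec M)) m) =
      ι (0 : QuadraticForm ℂ (Evec N)) (g m) := ExteriorAlgebra.map_apply_ι g
  induction x, hx using evenOdd_induction with
  | range_ι_pow v h =>
    obtain rfl | rfl : i = 0 ∨ i = 1 := (by decide : ∀ i : ZMod 2, i = 0 ∨ i = 1) i
    · obtain ⟨r, rfl⟩ := Submodule.mem_one.mp h
      exact (AlgHom.commutes (ExteriorAlgebra.map g) r).symm ▸ SetLike.algebraMap_mem_graded _ _
    · simp_rw [ZMod.val_one, pow_one] at h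
      obtain ⟨v, rfl⟩ := h
      rw [hι]
      exact ι_mem_evenOdd_one _ _
  | add x y hx hy ihx ihy =>
    rw [map_add]
    exact add_mem ihx ihy
  | ι_mul_ι_mul m₁ m₂ x hx ih =>
    rw [map_mul, map_mul, hι, hι]
    exact zero_add i ▸ SetLike.mul_mem_graded (ι_mul_ι_mem_evenOdd_zero _ _ _) ih

theorem wedgeList_mem_evenOdd {N : ℕ} (L : List (Fin N)) :
    wedgeList L ∈ evenOdd (0 : QuadraticForm ℂ (Evec N)) (L.length : ZMod 2) := by
  induction L with
  | nil => exact Submodule.one_le.1 (one_le_evenOdd_zero (0 : QuadraticForm ℂ (Evec N)))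
  | cons i L ih =>
    rw [wedgeList_cons, List.length_cons, Nat.cast_succ, add_comm]
    exact SetLike.mul_mem_graded (ι_mem_evenOdd_one _ _) ih

theorem wedgeFront_mem_evenOdd {N l : ℕ} (hN : Even N) (h : 2 * l ≤ N) {i : ZMod 2}
    {y : ExtE (2 * l)} (hy : y ∈ evenOdd (0 : QuadraticForm ℂ (Evec (2 * l))) i) :
    wedgeFront N l h y ∈ evenOdd (0 : QuadraticForm ℂ (Evec N)) i := by
  have h1 := wedgeList_mem_evenOdd (frontList N l)
  rw [(ZMod.natCast_eq_zero_iff_even).2 (even_length_frontList hN l)] at h1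
  exact zero_add i ▸ SetLike.mul_mem_graded h1 (map_mem_evenOdd _ hy)

theorem wedgeFront_mem_evenPart_iff {N l : ℕ} (hN : Even N) (h : 2 * l ≤ N) {y : ExtE (2 * l)} :
    wedgeFront N l h y ∈ evenPart N ↔ y ∈ evenPart (2 * l) := by
  refine ⟨fun hy => ?_, fun hy => wedgeFront_mem_evenOdd hN h hy⟩
  obtain ⟨y₀, hy₀, y₁, hy₁, rfl⟩ := Submodule.mem_sup.1
    ((evenOdd_isCompl (0 : QuadraticForm ℂ (Evec (2 * l)))).sup_eq_top ▸
      Submodule.mem_top : y ∈ _ ⊔ _)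
  have h0 : wedgeFront N l h y₁ ∈ evenPart N := by
    rw [map_add] at hy
    exact (add_mem_cancel_left (wedgeFront_mem_evenOdd hN h hy₀)).1 hy
  have h1 := Submodule.disjoint_def.1 (evenOdd_isCompl (0 : QuadraticForm ℂ (Evec N))).disjoint
    _ h0 (wedgeFront_mem_evenOdd hN h hy₁)
  rw [map_eq_zero_iff _ (wedgeFront_injective h)] at h1
  rw [h1, add_zero]
  exact hy₀

theorem purespinor_wedgeFront_iff {N l : ℕ} (hN : Even N) (h : 2 * l ≤ N) {y : ExtE (2 * l)} :
    purespinor (wedgeFront N l h y) ↔ purespinor y := by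
  rw [purespinor, purespinor, wedgeFront_mem_evenPart_iff hN h,
    map_ne_zero_iff _ (wedgeFront_injective h)]
  refine and_congr_right fun hy => and_congr_right fun _ => ?_
  rw [finrank_ker_psi_wedgeFront hN h hy]
  omega

/-- For `N` even and `2 ≤ l ≤ N/2 - 1`, the injective linear map
`w ↦ e_{[N-2l]} ∧ w` identifies the fibre over `span(e_1,…,e_{N-2l})` of the map
`ξ : Σ_{l,N} → OG(N-2l, V)`, `[a+b] ↦ H_a ∩ H_b`, with the maximal-distance secant
orbit `Σ_{l,2l}` of the smaller spinor variety `S_{2l}^+`. -/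
theorem stmt13 (N l : ℕ) (hN : Even N) (h6 : 6 ≤ N) (hl : 2 ≤ l) (hup : 2 * l + 2 ≤ N)
    (h2l : 2 * l ≤ N) :
    Set.BijOn
      (fun y : ExtE (2 * l) =>
        eI (Finset.univ.filter fun k : Fin N => k.1 < N - 2 * l) *
          ExteriorAlgebra.map (padMap N l h2l) y)
      {y : ExtE (2 * l) | ∃ a b : ExtE (2 * l), ∃ ha : purespinor a, ∃ hb : purespinor b,
        hdist (SpinorVariety (2 * l)) (Projectivization.mk ℂ a ha.1)
          (Projectivization.mk ℂ b hb.1) = l ∧ y = a + b}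
      {x : ExtE N | ∃ a b : ExtE N, ∃ ha : purespinor a, ∃ hb : purespinor b,
        hdist (SpinorVariety N) (Projectivization.mk ℂ a ha.1)
          (Projectivization.mk ℂ b hb.1) = l ∧ x = a + b ∧
        LinearMap.ker (psi a) ⊓ LinearMap.ker (psi b) =
          Submodule.span ℂ
            {v : Vsp N | ∃ i : Fin N, i.1 < N - 2 * l ∧ v = (Pi.single i 1, 0)}} := by
  change Set.BijOn (wedgeFront N l h2l) _ _
  refine ⟨?_, (wedgeFront_injective h2l).injOn, ?_⟩
  · rintro _ ⟨a, b, ha, hb, hd, rfl⟩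
    have hA := (purespinor_wedgeFront_iff hN h2l).2 ha
    have hB := (purespinor_wedgeFront_iff hN h2l).2 hb
    have hker := (ker_inf_ker_wedgeFront_iff hN h2l ha.1 hb.1).2
      (ker_inf_ker_eq_bot_of_hdist (by omega) ha hb hd)
    refine ⟨_, _, hA, hB, hdist_eq_of_finrank hA hB ?_, map_add _ _ _, hker⟩
    rw [hker, finrank_frontSpan]
    omega
  · rintro _ ⟨a, b, ha, hb, -, rfl, hker⟩
    have hmem : ∀ i : Fin N, i.1 < N - 2 * l →
        ((Pi.single i 1, 0) : Vsp N) ∈ LinearMap.ker (psi a) ⊓ LinearMap.ker (psi b) :=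
      fun i hi => hker ▸ Submodule.subset_span ⟨i, hi, rfl⟩
    obtain ⟨a, rfl⟩ := exists_eq_wedgeFront h2l fun i hi => (hmem i hi).1
    obtain ⟨b, rfl⟩ := exists_eq_wedgeFront h2l fun i hi => (hmem i hi).2
    rw [purespinor_wedgeFront_iff hN h2l] at ha hb
    have hbot := (ker_inf_ker_wedgeFront_iff hN h2l ha.1 hb.1).1 hker
    refine ⟨a + b, ⟨a, b, ha, hb, hdist_eq_of_finrank ha hb ?_, rfl⟩, map_add _ _ _⟩
    rw [hbot, finrank_bot, zero_add]
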